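/- arXiv:1203.1093 — 5 statements merged into one kernel-verified Lean document; each statement's English description precedes it below -/
import Mathlib

section
/- For every real θ, (1/(t·E(W))) ∫₀^∞ ∫_ℝ s(|u|/w)·w·φ(u−θ)·f_W(w) du dw = 1 + (1/(t·E(W))) ∫_{−k}^{k} (s(|x|) − t) · (∫₀^∞ φ(wx−θ)·w²·f_W(w) dw) dx, where E(W) = ∫₀^∞ w·f_W(w) dw. (That is, the scaled expected length of the confidence interval J(s) centred on the SCAD estimator equals the stated expression.) -/
open Real MeasureTheory Set Filter

/-- Standard normal probability density function. -/
noncomputable def phi (x : ℝ) : ℝ := (Real.sqrt (2 * Real.pi))⁻¹ * Real.exp (-x ^ 2 / 2)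

/-- Standard normal cumulative distribution function. -/
noncomputable def Phi (x : ℝ) : ℝ := ∫ u in Set.Iic x, phi u

/-- Density of W = sqrt(Q/m), Q ~ chi-squared with m degrees of freedom. -/
noncomputable def fW (m : ℕ) (w : ℝ) : ℝ :=
  (2 * (m : ℝ) ^ ((m : ℝ) / 2) / (Real.Gamma ((m : ℝ) / 2) * (2 : ℝ) ^ ((m : ℝ) / 2)))
    * w ^ ((m : ℝ) - 1) * Real.exp (-(m : ℝ) * w ^ 2 / 2)

/-- E(W). -/
noncomputable def EW (m : ℕ) : ℝ := ∫ w in Set.Ioi (0 : ℝ), w * fW m w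

/-- The SCAD map with tuning parameters a and η. -/
noncomputable def hSCAD (a η x : ℝ) : ℝ :=
  if |x| ≤ 2 * η then Real.sign x * max (|x| - η) 0
  else if |x| ≤ a * η then ((a - 1) * x - Real.sign x * a * η) / (a - 2)
  else x

/-- The SCAD map g(x, w), with thresholds scaled by w. -/
noncomputable def gSCAD (a η : ℝ) (x w : ℝ) : ℝ := hSCAD a (w * η) x

/-- The function b(w; m, k, θ) (for given t > 0). -/
noncomputable def bFun (t k θ w : ℝ) : ℝ :=
  if max (-(t * w)) (-(k * w) - θ) ≥ min (t * w) (k * w - θ) then 0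
  else Phi (min (t * w) (k * w - θ)) - Phi (max (-(t * w)) (-(k * w) - θ))

lemma phi_sub_eq_gaussianPDFReal (θ u : ℝ) :
    phi (u - θ) = ProbabilityTheory.gaussianPDFReal θ 1 u := by
  simp [phi, ProbabilityTheory.gaussianPDFReal]

lemma integrable_phi_sub (θ : ℝ) : Integrable fun u => phi (u - θ) := by
  simp_rw [phi_sub_eq_gaussianPDFReal]
  exact ProbabilityTheory.integrable_gaussianPDFReal θ 1

lemma integral_phi_sub (θ : ℝ) : ∫ u, phi (u - θ) = 1 := by
  simp_rw [phi_sub_eq_gaussianPDFReal]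
  exact ProbabilityTheory.integral_gaussianPDFReal_eq_one θ one_ne_zero

lemma continuous_phi : Continuous phi := by
  unfold phi
  fun_prop

lemma phi_nonneg (x : ℝ) : 0 ≤ phi x := by
  unfold phi
  positivity

lemma phi_le (x : ℝ) : phi x ≤ (Real.sqrt (2 * Real.pi))⁻¹ := by
  unfold phi
  refine mul_le_of_le_one_right (by positivity) (Real.exp_le_one_iff.2 ?_)
  nlinarith [sq_nonneg x]

lemma measurable_fW (m : ℕ) : Measurable (fW m) := by
  unfold fW
  fun_prop

lemma fW_pos {m : ℕ} (hm : 0 < m) {w : ℝ} (hw : 0 < w) : 0 < fW m w := by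
  have h : 0 < Real.Gamma ((m : ℝ) / 2) := Real.Gamma_pos_of_pos (by positivity)
  unfold fW
  positivity

lemma integrableOn_pow_mul_fW {m : ℕ} (hm : 0 < m) (n : ℕ) :
    IntegrableOn (fun w => w ^ n * fW m w) (Ioi 0) := by
  have hm' : (0 : ℝ) < m := by exact_mod_cast hm
  have h := (integrableOn_rpow_mul_exp_neg_mul_sq (b := (m : ℝ) / 2) (by positivity)
    (s := (m : ℝ) - 1 + n) (by linarith [(Nat.cast_nonneg n : (0 : ℝ) ≤ n)])).const_mul
    (2 * (m : ℝ) ^ ((m : ℝ) / 2) / (Real.Gamma ((m : ℝ) / 2) * (2 : ℝ) ^ ((m : ℝ) / 2)))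
  refine IntegrableOn.congr_fun h (fun w hw => ?_) measurableSet_Ioi
  have hexp : -((m : ℝ) / 2) * w ^ 2 = -(m : ℝ) * w ^ 2 / 2 := by ring
  simp only [fW]
  rw [Real.rpow_add hw, Real.rpow_natCast, hexp]
  ring

lemma EW_pos {m : ℕ} (hm : 0 < m) : 0 < EW m := by
  have hint := integrableOn_pow_mul_fW hm 1
  simp only [pow_one] at hint
  have hpos : ∀ w ∈ Ioi (0 : ℝ), 0 < w * fW m w := fun w hw => mul_pos hw (fW_pos hm hw)
  unfold EW
  rw [setIntegral_pos_iff_support_of_nonneg_ae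
    ((ae_restrict_iff' measurableSet_Ioi).2 (ae_of_all _ fun w hw => (hpos w hw).le)) hint,
    inter_eq_right.2 fun w hw => Function.mem_support.2 (hpos w hw).ne']
  simp

/-- Change of variables `u = w * x` in the inner integral. -/
lemma integral_comp_div_mul_phi_sub (g : ℝ → ℝ) (θ : ℝ) {w : ℝ} (hw : 0 < w) :
    ∫ u, g (u / w) * phi (u - θ) = w * ∫ x, g x * phi (w * x - θ) := by
  have h := Measure.integral_comp_div (fun x => g x * phi (w * x - θ)) w
  rw [abs_of_pos hw, smul_eq_mul] at h
  rw [← h]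
  simp_rw [mul_div_cancel₀ _ hw.ne']

theorem scaled_expected_length_formula (m : ℕ) (hm : 0 < m) (η k t : ℝ) (hη : 0 < η) (hk : k = 3.7 * η)
    (ht : 0 < t) (s : ℝ → ℝ) (hs_cont : ContinuousOn s (Set.Ici 0))
    (hs_pos : ∀ x, 0 ≤ x → 0 < s x) (hs_t : ∀ x, k ≤ x → s x = t) (θ : ℝ) :
    (1 / (t * EW m)) *
        (∫ w in Set.Ioi (0 : ℝ), ∫ u : ℝ, s (|u| / w) * w * phi (u - θ) * fW m w) =
      1 + (1 / (t * EW m)) *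
        ∫ x in (-k)..k, (s |x| - t) *
          ∫ w in Set.Ioi (0 : ℝ), phi (w * x - θ) * w ^ 2 * fW m w := by
  have hE := EW_pos hm
  have hk0 : 0 ≤ k := by rw [hk]; positivity
  set g : ℝ → ℝ := fun x => s |x| - t with hg
  have hg_cont : Continuous g :=
    (hs_cont.comp_continuous continuous_abs fun x => abs_nonneg x).sub continuous_const
  have hg_zero : ∀ x, k ≤ |x| → g x = 0 := fun x hx => by simp [hg, hs_t _ hx]
  obtain ⟨C, hC⟩ := (isCompact_Icc (a := -k) (b := k)).exists_bound_of_continuousOn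
    hg_cont.continuousOn
  have hC0 : 0 ≤ C := (norm_nonneg _).trans (hC 0 ⟨by linarith, hk0⟩)
  have hgC : ∀ x, ‖g x‖ ≤ C := fun x => by
    rcases le_total |x| k with h | h
    · exact hC x (abs_le.1 h)
    · simpa [hg_zero x h] using hC0
  have hprod : Integrable
      (Function.uncurry fun w x => g x * (phi (w * x - θ) * w ^ 2 * fW m w))
      ((volume.restrict (Ioi 0)).prod (volume.restrict (Ioc (-k) k))) := by
    have hbound := (integrableOn_pow_mul_fW hm 2).mul_prod
      (integrable_const (μ := volume.restrict (Ioc (-k) k)) (C * (Real.sqrt (2 * Real.pi))⁻¹))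
    refine hbound.mono ?_ (ae_of_all _ fun ⟨w, x⟩ => ?_)
    · have := continuous_phi.measurable
      have := hg_cont.measurable
      have := measurable_fW m
      simp only [Function.uncurry_def]
      exact Measurable.aestronglyMeasurable (by fun_prop)
    · simp only [Function.uncurry_apply_pair, norm_mul]
      have h1 : ‖phi (w * x - θ)‖ ≤ ‖(Real.sqrt (2 * Real.pi))⁻¹‖ := by
        rw [Real.norm_of_nonneg (phi_nonneg _), Real.norm_of_nonneg (by positivity)]
        exact phi_le _
      have h2 : ‖g x‖ ≤ ‖C‖ := (hgC x).trans (le_abs_self C)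
      calc ‖g x‖ * (‖phi (w * x - θ)‖ * ‖w ^ 2‖ * ‖fW m w‖)
          ≤ ‖C‖ * (‖(Real.sqrt (2 * Real.pi))⁻¹‖ * ‖w ^ 2‖ * ‖fW m w‖) := by gcongr
        _ = ‖w ^ 2‖ * ‖fW m w‖ * (‖C‖ * ‖(Real.sqrt (2 * Real.pi))⁻¹‖) := by ring
  have hinner : ∀ w ∈ Ioi (0 : ℝ), ∫ u : ℝ, s (|u| / w) * w * phi (u - θ) * fW m w =
      t * (w * fW m w) + ∫ x in Ioc (-k) k, g x * (phi (w * x - θ) * w ^ 2 * fW m w) := by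
    intro w hw
    have hw0 : 0 < w := hw
    have hsplit : ∀ u, s (|u| / w) * w * phi (u - θ) * fW m w =
        t * (w * fW m w) * phi (u - θ) + w * fW m w * (g (u / w) * phi (u - θ)) := by
      intro u
      simp only [hg, abs_div, abs_of_pos hw0]
      ring
    have hint : Integrable fun u => g (u / w) * phi (u - θ) :=
      (integrable_phi_sub θ).bdd_mul
        (hg_cont.comp (continuous_id.div_const w)).aestronglyMeasurable
        (ae_of_all _ fun u => hgC (u / w))
    simp_rw [hsplit]
    rw [integral_add ((integrable_phi_sub θ).const_mul _) (hint.const_mul _),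
      integral_const_mul, integral_const_mul, integral_phi_sub, mul_one,
      integral_comp_div_mul_phi_sub g θ hw0,
      ← setIntegral_eq_integral_of_forall_compl_eq_zero (s := Ioc (-k) k),
      ← mul_assoc (w * fW m w) w,
      ← integral_const_mul]
    · congr 1
      refine integral_congr_ae (ae_of_all _ fun x => ?_)
      ring
    · intro x hx
      rw [hg_zero x, zero_mul]
      by_contra! h
      exact hx ⟨(abs_lt.1 h).1, (abs_lt.1 h).2.le⟩
  have hW : IntegrableOn (fun w => t * (w * fW m w)) (Ioi 0) := by
    simpa [IntegrableOn] using (integrableOn_pow_mul_fW hm 1).const_mul t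
  have hG : IntegrableOn (fun w => ∫ x in Ioc (-k) k,
      g x * (phi (w * x - θ) * w ^ 2 * fW m w)) (Ioi 0) := hprod.integral_prod_left
  rw [setIntegral_congr_fun measurableSet_Ioi hinner, integral_add hW hG,
    integral_integral_swap hprod, integral_const_mul,
    intervalIntegral.integral_of_le (by linarith)]
  simp_rw [integral_const_mul]
  change 1 / (t * EW m) * (t * EW m + _) = _
  rw [mul_add, one_div_mul_cancel (mul_pos ht hE).ne']
end

section
/- At θ = 0 the scaled expected length of J(s) has the closed form: 1 + (1/(t·E(W))) ∫_{−k}^{k} (s(|x|) − t) · (∫₀^∞ φ(wx)·w²·f_W(w) dw) dx = 1 + (√(2/π)/(t·E(W))) ∫₀^{k} (s(x) − t) · (m/(x² + m))^{(m/2)+1} dx, where E(W) = ∫₀^∞ w·f_W(w) dw. -/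
open Real MeasureTheory Set Filter

/-- Integrating out `w` from `phi (w * x) * w ^ 2 * fW m w` leaves a power of `m / (x ^ 2 + m)`. -/
lemma integral_phi_mul_sq_mul_fW {m : ℕ} (hm : 0 < m) (x : ℝ) :
    ∫ w in Set.Ioi (0 : ℝ), phi (w * x) * w ^ 2 * fW m w =
      (Real.sqrt (2 * Real.pi))⁻¹ * ((m : ℝ) / (x ^ 2 + m)) ^ ((m : ℝ) / 2 + 1) := by
  have hm' : (0 : ℝ) < m := by exact_mod_cast hm
  have hd : 0 < x ^ 2 + m := by positivity
  have hΓ : 0 < Real.Gamma ((m : ℝ) / 2) := Real.Gamma_pos_of_pos (by positivity)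
  have h2 : (0 : ℝ) < 2 ^ ((m : ℝ) / 2) := by positivity
  have hfun : ∀ w ∈ Set.Ioi (0 : ℝ), phi (w * x) * w ^ 2 * fW m w =
      ((Real.sqrt (2 * Real.pi))⁻¹ *
        (2 * (m : ℝ) ^ ((m : ℝ) / 2) / (Real.Gamma ((m : ℝ) / 2) * (2 : ℝ) ^ ((m : ℝ) / 2)))) *
        (w ^ ((m : ℝ) + 1) * Real.exp (-((x ^ 2 + m) / 2) * w ^ (2 : ℝ))) := by
    intro w hw
    have hw : 0 < w := hw
    have hpow : w ^ ((m : ℝ) + 1) = w ^ 2 * w ^ ((m : ℝ) - 1) := by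
      rw [← Real.rpow_natCast w 2, ← Real.rpow_add hw]
      congr 1
      push_cast
      ring
    have hexp : Real.exp (-((x ^ 2 + m) / 2) * w ^ (2 : ℝ)) =
        Real.exp (-(w * x) ^ 2 / 2) * Real.exp (-(m : ℝ) * w ^ 2 / 2) := by
      rw [← Real.exp_add, Real.rpow_two]
      congr 1
      ring
    rw [hpow, hexp, phi, fW]
    ring
  rw [setIntegral_congr_fun measurableSet_Ioi hfun, integral_const_mul,
    integral_rpow_mul_exp_neg_mul_rpow (by norm_num) (by linarith) (by positivity)]
  have e1 : -((m : ℝ) + 1 + 1) / 2 = -((m : ℝ) / 2 + 1) := by ring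
  have e2 : ((m : ℝ) + 1 + 1) / 2 = (m : ℝ) / 2 + 1 := by ring
  rw [e1, e2, Real.Gamma_add_one (by positivity), Real.rpow_neg (by positivity),
    Real.div_rpow hd.le (by norm_num), Real.div_rpow hm'.le hd.le,
    Real.rpow_add_one (x := (2 : ℝ)) (by norm_num), Real.rpow_add_one hm'.ne']
  have hD : 0 < (x ^ 2 + (m : ℝ)) ^ ((m : ℝ) / 2 + 1) := by positivity
  have hs : 0 < Real.sqrt (2 * Real.pi) := by positivity
  field_simp

/-- Over a symmetric interval, a function of `|x|` integrates to twice its integral over the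
nonnegative half. -/
lemma intervalIntegral_comp_abs_symm (f : ℝ → ℝ) {k : ℝ} (hk : 0 ≤ k) :
    ∫ x in (-k)..k, f |x| = 2 * ∫ x in (0 : ℝ)..k, f x := by
  have h := integral_comp_abs (f := (Set.Iic k).indicator f)
  have hl : (fun x : ℝ => (Set.Iic k).indicator f |x|) =
      (Set.Icc (-k) k).indicator (fun x => f |x|) := by
    ext x
    simp only [Set.indicator_apply, Set.mem_Iic, Set.mem_Icc, abs_le]
  rw [hl, integral_indicator measurableSet_Icc, setIntegral_indicator measurableSet_Iic,
    Set.Ioi_inter_Iic, integral_Icc_eq_integral_Ioc] at h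
  rwa [intervalIntegral.integral_of_le (by linarith), intervalIntegral.integral_of_le hk]

lemma two_mul_inv_sqrt_two_mul_pi :
    2 * (Real.sqrt (2 * Real.pi))⁻¹ = Real.sqrt (2 / Real.pi) := by
  have h2 : Real.sqrt 2 ^ 2 = 2 := Real.sq_sqrt (by norm_num)
  rw [Real.sqrt_mul (by norm_num), Real.sqrt_div (by norm_num)]
  field_simp
  exact h2.symm


theorem scaled_expected_length_at_zero (m : ℕ) (hm : 0 < m) (η k t : ℝ) (hη : 0 < η) (hk : k = 3.7 * η)
    (ht : 0 < t) (s : ℝ → ℝ) (hs_cont : ContinuousOn s (Set.Ici 0))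
    (hs_pos : ∀ x, 0 ≤ x → 0 < s x) (hs_t : ∀ x, k ≤ x → s x = t) :
    1 + (1 / (t * EW m)) *
        (∫ x in (-k)..k, (s |x| - t) *
          ∫ w in Set.Ioi (0 : ℝ), phi (w * x) * w ^ 2 * fW m w) =
      1 + (Real.sqrt (2 / Real.pi) / (t * EW m)) *
        ∫ x in (0 : ℝ)..k, (s x - t) * ((m : ℝ) / (x ^ 2 + m)) ^ ((m : ℝ) / 2 + 1) := by
  have hk0 : 0 ≤ k := by rw [hk]; positivity
  have hint : ∀ x : ℝ, (s |x| - t) * ∫ w in Set.Ioi (0 : ℝ), phi (w * x) * w ^ 2 * fW m w =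
      (Real.sqrt (2 * Real.pi))⁻¹ *
        ((s |x| - t) * ((m : ℝ) / (|x| ^ 2 + m)) ^ ((m : ℝ) / 2 + 1)) := by
    intro x
    rw [integral_phi_mul_sq_mul_fW hm, sq_abs]
    ring
  simp_rw [hint]
  rw [intervalIntegral.integral_const_mul,
    intervalIntegral_comp_abs_symm
      (fun x => (s x - t) * ((m : ℝ) / (x ^ 2 + m)) ^ ((m : ℝ) / 2 + 1)) hk0,
    ← two_mul_inv_sqrt_two_mul_pi]
  ring
end

section
/- For every real x, ∫₀^∞ φ(wx)·w²·f_W(w) dw = (1/√(2π)) · (m/(x² + m))^{(m/2)+1}. -/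
open Real MeasureTheory Set Filter

theorem gaussian_scale_mixture_wsq (m : ℕ) (hm : 0 < m) (x : ℝ) :
    (∫ w in Set.Ioi (0 : ℝ), phi (w * x) * w ^ 2 * fW m w) =
      (Real.sqrt (2 * Real.pi))⁻¹ * ((m : ℝ) / (x ^ 2 + m)) ^ ((m : ℝ) / 2 + 1) := by
  have hm' : (0 : ℝ) < m := by exact_mod_cast hm
  have hs : 0 < x ^ 2 + (m : ℝ) := by positivity
  set C : ℝ := (2 * (m : ℝ) ^ ((m : ℝ) / 2) /
    (Real.Gamma ((m : ℝ) / 2) * (2 : ℝ) ^ ((m : ℝ) / 2))) with hC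
  have integrand_eq : ∀ w ∈ Set.Ioi (0 : ℝ), phi (w * x) * w ^ 2 * fW m w =
      (Real.sqrt (2 * Real.pi))⁻¹ * C *
        (w ^ ((m : ℝ) + 1) * Real.exp (-((x ^ 2 + m) / 2) * w ^ (2 : ℝ))) := by
    intro w hw
    have hpow : w ^ ((m : ℝ) + 1) = w ^ 2 * w ^ ((m : ℝ) - 1) := by
      rw [← Real.rpow_two, ← Real.rpow_add hw]
      ring_nf
    have hexp : Real.exp (-((x ^ 2 + m) / 2) * w ^ (2 : ℝ)) =
        Real.exp (-(w * x) ^ 2 / 2) * Real.exp (-(m : ℝ) * w ^ 2 / 2) := by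
      rw [Real.rpow_two, ← Real.exp_add]
      ring_nf
    rw [hpow, hexp, phi, fW, ← hC]
    ring
  rw [setIntegral_congr_fun measurableSet_Ioi integrand_eq, integral_const_mul,
    integral_rpow_mul_exp_neg_mul_rpow two_pos (by linarith) (half_pos hs), mul_assoc]
  congr 1
  have hhalf : ((m : ℝ) + 1 + 1) / 2 = (m : ℝ) / 2 + 1 := by ring
  have hG : Real.Gamma ((m : ℝ) / 2) ≠ 0 := (Real.Gamma_pos_of_pos (half_pos hm')).ne'
  have h2 : (2 : ℝ) ^ ((m : ℝ) / 2) ≠ 0 := by positivity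
  have hS : (x ^ 2 + (m : ℝ)) ^ ((m : ℝ) / 2) ≠ 0 := by positivity
  rw [neg_div, hhalf, Real.Gamma_add_one (half_pos hm').ne', Real.rpow_neg (by positivity),
    Real.div_rpow hs.le zero_le_two, Real.div_rpow hm'.le hs.le, Real.rpow_add_one hs.ne',
    Real.rpow_add_one two_ne_zero, Real.rpow_add_one hm'.ne', hC]
  field_simp
end

section
/- The coverage probability of J(s) converges to the nominal level as θ → ∞: C(θ) = ∫₀^∞ ∫_ℝ 1{g(u,w) − w·s(|u|/w) ≤ θ ≤ g(u,w) + w·s(|u|/w)}·φ(u−θ)·f_W(w) du dw → 1 − α as θ → ∞, where 1 − α = ∫₀^∞ (Φ(tw) − Φ(−tw))·f_W(w) dw. -/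
open Real MeasureTheory Set Filter

lemma integrable_phi : Integrable phi := by
  have h := (integrable_exp_neg_mul_sq (b := 1 / 2) (by norm_num)).const_mul
    (Real.sqrt (2 * Real.pi))⁻¹
  refine h.congr (.of_forall fun x => ?_)
  simp only [phi]
  ring_nf

lemma integrableOn_fW {m : ℕ} (hm : 0 < m) : IntegrableOn (fW m) (Ioi 0) := by
  have hm' : (0 : ℝ) < m := by exact_mod_cast hm
  have h := (integrableOn_rpow_mul_exp_neg_mul_sq (b := (m : ℝ) / 2) (s := (m : ℝ) - 1)
    (by positivity) (by linarith)).const_mul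
    (2 * (m : ℝ) ^ ((m : ℝ) / 2) / (Real.Gamma ((m : ℝ) / 2) * (2 : ℝ) ^ ((m : ℝ) / 2)))
  refine h.congr (.of_forall fun x => ?_)
  simp only [fW]
  ring_nf

lemma fW_nonneg {m : ℕ} (hm : 0 < m) {w : ℝ} (hw : 0 < w) : 0 ≤ fW m w := by
  have hm' : (0 : ℝ) < m := by exact_mod_cast hm
  have := Real.Gamma_pos_of_pos (half_pos hm')
  unfold fW
  positivity

lemma Real.measurable_sign : Measurable Real.sign :=
  Measurable.ite measurableSet_Iio measurable_const
    (Measurable.ite measurableSet_Ioi measurable_const measurable_const)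

lemma measurable_gSCAD (a η : ℝ) : Measurable fun p : ℝ × ℝ => gSCAD a η p.1 p.2 := by
  have hsign : Measurable fun p : ℝ × ℝ => Real.sign p.1 :=
    Real.measurable_sign.comp measurable_fst
  have habs : Measurable fun p : ℝ × ℝ => |p.1| := measurable_fst.abs
  unfold gSCAD hSCAD
  refine Measurable.ite (measurableSet_le habs (by fun_prop)) (by fun_prop)
    (Measurable.ite (measurableSet_le habs (by fun_prop)) (by fun_prop) measurable_fst)

lemma gSCAD_of_lt {a η x w : ℝ} (ha : 2 ≤ a) (hη : 0 ≤ w * η) (h : a * (w * η) < |x|) :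
    gSCAD a η x w = x := by
  have h2 : 2 * (w * η) < |x| := (mul_le_mul_of_nonneg_right ha hη).trans_lt h
  simp [gSCAD, hSCAD, h.not_ge, h2.not_ge]

lemma Phi_sub_Phi_neg {x : ℝ} (hx : 0 ≤ x) :
    Phi x - Phi (-x) = ∫ v, (if -x ≤ v ∧ v ≤ x then (1 : ℝ) else 0) * phi v := by
  unfold Phi
  rw [intervalIntegral.integral_Iic_sub_Iic integrable_phi.integrableOn
    integrable_phi.integrableOn, intervalIntegral.integral_of_le (by linarith),
    ← integral_Icc_eq_integral_Ioc, ← integral_indicator measurableSet_Icc]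
  congr 1 with v
  simp [indicator_apply]

/-- The integrand of the coverage probability. -/
noncomputable def coverageIntegrand (m : ℕ) (a η : ℝ) (s : ℝ → ℝ) (θ w u : ℝ) : ℝ :=
  (if gSCAD a η u w - w * s (|u| / w) ≤ θ ∧ θ ≤ gSCAD a η u w + w * s (|u| / w)
    then (1 : ℝ) else 0) * phi (u - θ) * fW m w

lemma measurable_coverageIntegrand (m : ℕ) (a η θ : ℝ) {s : ℝ → ℝ} (hs : Measurable s) :
    Measurable fun p : ℝ × ℝ => coverageIntegrand m a η s θ p.1 p.2 := by
  have hg : Measurable fun p : ℝ × ℝ => gSCAD a η p.2 p.1 :=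
    (measurable_gSCAD a η).comp measurable_swap
  have hs' : Measurable fun p : ℝ × ℝ => p.1 * s (|p.2| / p.1) :=
    measurable_fst.mul (hs.comp (measurable_snd.abs.div measurable_fst))
  have hphi : Measurable fun p : ℝ × ℝ => phi (p.2 - θ) :=
    continuous_phi.measurable.comp (measurable_snd.sub_const θ)
  have hf : Measurable fun p : ℝ × ℝ => fW m p.1 := (measurable_fW m).comp measurable_fst
  refine (Measurable.mul (Measurable.ite ?_ measurable_const measurable_const) hphi).mul hf
  exact (measurableSet_le (hg.sub hs') measurable_const).inter
    (measurableSet_le measurable_const (hg.add hs'))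

lemma norm_coverageIntegrand_le {m : ℕ} (hm : 0 < m) (a η : ℝ) (s : ℝ → ℝ) (θ u : ℝ) {w : ℝ}
    (hw : 0 < w) : ‖coverageIntegrand m a η s θ w u‖ ≤ phi (u - θ) * fW m w := by
  have := mul_nonneg (phi_nonneg (u - θ)) (fW_nonneg hm hw)
  unfold coverageIntegrand
  split_ifs
  · rw [one_mul, Real.norm_of_nonneg this]
  · simpa using this

lemma eventually_coverageIntegrand_add {a η t : ℝ} (m : ℕ) (ha : 2 ≤ a) (hη : 0 ≤ η)
    {s : ℝ → ℝ} (hs : ∀ x, a * η ≤ x → s x = t) {w : ℝ} (hw : 0 < w) (v : ℝ) :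
    ∀ᶠ θ in atTop, coverageIntegrand m a η s θ w (v + θ) =
      (if -(t * w) ≤ v ∧ v ≤ t * w then (1 : ℝ) else 0) * phi v * fW m w := by
  filter_upwards [eventually_gt_atTop (a * (w * η) - v)] with θ hθ
  have h : a * (w * η) < |v + θ| := lt_of_lt_of_le (by linarith) (le_abs_self _)
  have hsw : s (|v + θ| / w) = t := hs _ <| by
    rw [le_div_iff₀ hw]
    linarith
  unfold coverageIntegrand
  rw [gSCAD_of_lt ha (by positivity) h, hsw, add_sub_cancel_right]
  congr 3
  refine propext ⟨fun h => ⟨?_, ?_⟩, fun h => ⟨?_, ?_⟩⟩ <;> linarith [h.1, h.2]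

lemma tendsto_integral_coverageIntegrand {m : ℕ} (hm : 0 < m) {a η t : ℝ} (ha : 2 ≤ a)
    (hη : 0 ≤ η) (ht : 0 ≤ t) {s : ℝ → ℝ} (hs_meas : Measurable s)
    (hs : ∀ x, a * η ≤ x → s x = t) {w : ℝ} (hw : 0 < w) :
    Tendsto (fun θ => ∫ u, coverageIntegrand m a η s θ w u) atTop
      (nhds ((Phi (t * w) - Phi (-(t * w))) * fW m w)) := by
  rw [Phi_sub_Phi_neg (by positivity), ← integral_mul_const]
  refine Tendsto.congr
    (fun θ => integral_add_right_eq_self (coverageIntegrand m a η s θ w) θ) ?_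
  refine tendsto_integral_filter_of_dominated_convergence (fun v => phi v * fW m w)
    (.of_forall fun θ => ?_) (.of_forall fun θ => .of_forall fun v => ?_)
    (integrable_phi.mul_const _) (.of_forall fun v => ?_)
  · exact ((measurable_coverageIntegrand m a η θ hs_meas).comp
      (measurable_const.prodMk (measurable_id.add_const θ))).aestronglyMeasurable
  · simpa using norm_coverageIntegrand_le hm a η s θ (v + θ) hw
  · exact tendsto_nhds_of_eventually_eq (eventually_coverageIntegrand_add m ha hη hs hw v)

lemma tendsto_integral_integral_coverageIntegrand {m : ℕ} (hm : 0 < m) {a η t : ℝ}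
    (ha : 2 ≤ a) (hη : 0 ≤ η) (ht : 0 ≤ t) {s : ℝ → ℝ} (hs_meas : Measurable s)
    (hs : ∀ x, a * η ≤ x → s x = t) :
    Tendsto (fun θ => ∫ w in Ioi (0 : ℝ), ∫ u, coverageIntegrand m a η s θ w u) atTop
      (nhds (∫ w in Ioi (0 : ℝ), (Phi (t * w) - Phi (-(t * w))) * fW m w)) := by
  refine tendsto_integral_filter_of_dominated_convergence (fun w => (∫ v, phi v) * fW m w)
    (.of_forall fun θ => ?_) (.of_forall fun θ => ?_)
    ((integrableOn_fW hm).const_mul _) ?_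
  · exact (measurable_coverageIntegrand m a η θ
      hs_meas).stronglyMeasurable.integral_prod_right'.aestronglyMeasurable
  · filter_upwards [ae_restrict_mem measurableSet_Ioi] with w hw
    rw [← integral_sub_right_eq_self phi θ, ← integral_mul_const]
    exact norm_integral_le_of_norm_le ((integrable_phi.comp_sub_right θ).mul_const _)
      (.of_forall fun u => norm_coverageIntegrand_le hm a η s θ u hw)
  · filter_upwards [ae_restrict_mem measurableSet_Ioi] with w hw
    exact tendsto_integral_coverageIntegrand hm ha hη ht hs_meas hs hw

theorem coverage_probability_tendsto_nominal (m : ℕ) (hm : 0 < m) (η k t α : ℝ)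
    (hη : 0 < η) (hk : k = 3.7 * η) (hα : α ∈ Set.Ioo (0 : ℝ) 1) (ht : 0 < t)
    (htα : (∫ w in Set.Ioi (0 : ℝ), (Phi (t * w) - Phi (-(t * w))) * fW m w) = 1 - α)
    (s : ℝ → ℝ) (hs_cont : ContinuousOn s (Set.Ici 0))
    (hs_pos : ∀ x, 0 ≤ x → 0 < s x) (hs_t : ∀ x, k ≤ x → s x = t) :
    Filter.Tendsto
      (fun θ : ℝ => ∫ w in Set.Ioi (0 : ℝ), ∫ u : ℝ,
        (if gSCAD 3.7 η u w - w * s (|u| / w) ≤ θ ∧ θ ≤ gSCAD 3.7 η u w + w * s (|u| / w)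
          then (1 : ℝ) else 0) * phi (u - θ) * fW m w)
      Filter.atTop (nhds (1 - α)) := by
  subst hk
  have hs_meas : Measurable fun x => s (max x 0) :=
    (hs_cont.comp_continuous (by fun_prop) fun x => le_max_right x 0).measurable
  have hs_max : ∀ x, 3.7 * η ≤ x → s (max x 0) = t := fun x hx =>
    hs_t _ (hx.trans (le_max_left x 0))
  rw [← htα]
  refine (tendsto_integral_integral_coverageIntegrand hm (by norm_num) hη.le ht.le hs_meas
    hs_max).congr fun θ => setIntegral_congr_fun measurableSet_Ioi fun w hw => ?_
  have hmax (u : ℝ) : max (|u| / w) 0 = |u| / w :=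
    max_eq_left (div_nonneg (abs_nonneg u) (le_of_lt hw))
  simp only [coverageIntegrand, hmax]
end

section
/- Inner coverage integral at θ = 0: for every real x, ∫₀^∞ 1{h(x) − s(|x|) ≤ 0 ≤ h(x) + s(|x|)}·φ(wx)·w·f_W(w) dw equals (1/√π)·(Γ((m+1)/2)/Γ(m/2))·(m/(x² + m))^{m/2}·(x² + m)^{−1/2} if h(x) − s(|x|) ≤ 0 and h(x) + s(|x|) ≥ 0, and equals 0 otherwise. -/
open Real MeasureTheory Set Filter

/-- On `w > 0` the joint density factor is a constant times a generalized Gaussian kernel. -/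
lemma phi_mul_mul_fW (m : ℕ) (x : ℝ) {w : ℝ} (hw : 0 < w) :
    phi (w * x) * w * fW m w =
      ((Real.sqrt (2 * Real.pi))⁻¹ *
        (2 * (m : ℝ) ^ ((m : ℝ) / 2) /
          (Real.Gamma ((m : ℝ) / 2) * (2 : ℝ) ^ ((m : ℝ) / 2)))) *
        (w ^ (m : ℝ) * Real.exp (-((x ^ 2 + m) / 2) * w ^ (2 : ℝ))) := by
  have hpow : w ^ (m : ℝ) = w * w ^ ((m : ℝ) - 1) := by
    rw [Real.rpow_sub_one hw.ne', mul_div_cancel₀ _ hw.ne']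
  have hexp : Real.exp (-((x ^ 2 + m) / 2) * w ^ (2 : ℝ)) =
      Real.exp (-(w * x) ^ 2 / 2) * Real.exp (-(m : ℝ) * w ^ 2 / 2) := by
    rw [← Real.exp_add, Real.rpow_two]
    congr 1
    ring
  rw [phi, fW, hpow, hexp]
  ring

/-- The integral of `φ(wx) w f_W(w)` over `w > 0`, up to normalization a Student `t` density. -/
lemma integral_phi_mul_mul_fW {m : ℕ} (hm : 0 < m) (x : ℝ) :
    ∫ w in Set.Ioi (0 : ℝ), phi (w * x) * w * fW m w =
      (Real.sqrt Real.pi)⁻¹ * (Real.Gamma (((m : ℝ) + 1) / 2) / Real.Gamma ((m : ℝ) / 2)) *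
        ((m : ℝ) / (x ^ 2 + m)) ^ ((m : ℝ) / 2) * (x ^ 2 + (m : ℝ)) ^ (-(1 : ℝ) / 2) := by
  have hm' : (0 : ℝ) < m := Nat.cast_pos.mpr hm
  have hy : 0 < x ^ 2 + (m : ℝ) := by positivity
  have hΓ : Real.Gamma ((m : ℝ) / 2) ≠ 0 := (Real.Gamma_pos_of_pos (by positivity)).ne'
  have hb : ((x ^ 2 + (m : ℝ)) / 2) ^ (-((m : ℝ) + 1) / 2) =
      ((x ^ 2 + (m : ℝ)) ^ ((m : ℝ) / 2))⁻¹ * (x ^ 2 + (m : ℝ)) ^ (-(1 : ℝ) / 2) *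
        ((2 : ℝ) ^ ((m : ℝ) / 2) * Real.sqrt 2) := by
    rw [Real.div_rpow hy.le zero_le_two,
      show -((m : ℝ) + 1) / 2 = -((m : ℝ) / 2) + -(1 : ℝ) / 2 by ring,
      Real.rpow_add hy, Real.rpow_add zero_lt_two, Real.rpow_neg hy.le,
      Real.rpow_neg zero_le_two, neg_div, Real.rpow_neg zero_le_two, Real.sqrt_eq_rpow]
    field_simp
  rw [setIntegral_congr_fun measurableSet_Ioi fun w hw => phi_mul_mul_fW m x hw,
    integral_const_mul, integral_rpow_mul_exp_neg_mul_rpow two_pos (by linarith) (by positivity),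
    hb, Real.div_rpow hm'.le hy.le, Real.sqrt_mul zero_le_two]
  field_simp

theorem inner_coverage_integral_at_zero (m : ℕ) (hm : 0 < m) (η k t : ℝ) (hη : 0 < η) (hk : k = 3.7 * η)
    (ht : 0 < t) (s : ℝ → ℝ) (hs_cont : ContinuousOn s (Set.Ici 0))
    (hs_pos : ∀ x, 0 ≤ x → 0 < s x) (hs_t : ∀ x, k ≤ x → s x = t) (x : ℝ) :
    (∫ w in Set.Ioi (0 : ℝ),
        (if hSCAD 3.7 η x - s |x| ≤ 0 ∧ (0 : ℝ) ≤ hSCAD 3.7 η x + s |x|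
          then (1 : ℝ) else 0) * phi (w * x) * w * fW m w) =
      if hSCAD 3.7 η x - s |x| ≤ 0 ∧ (0 : ℝ) ≤ hSCAD 3.7 η x + s |x| then
        (Real.sqrt Real.pi)⁻¹ * (Real.Gamma (((m : ℝ) + 1) / 2) / Real.Gamma ((m : ℝ) / 2)) *
          ((m : ℝ) / (x ^ 2 + m)) ^ ((m : ℝ) / 2) * (x ^ 2 + (m : ℝ)) ^ (-(1 : ℝ) / 2)
      else 0 := by
  split_ifs
  · simpa only [one_mul] using integral_phi_mul_mul_fW hm x
  · simp
end
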